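/- Let E and F be real Banach spaces, let x ∈ F, let g : F → E be continuously Fréchet differentiable on a neighborhood of x (with Fréchet derivative Dg(x) at x), and let f : E → ℝ be Lipschitz on a neighborhood of g(x). Then for every direction v ∈ F, the Clarke directional derivative of the composition satisfies (f ∘ g)°(x, v) ≤ f°(g(x), Dg(x)v). -/

import Mathlib

open Filter Topology

/-- The Clarke (generalized) directional derivative of `f` at `y` in direction `w`:
`f°(y, w) = limsup_{ỹ → y, τ → 0+} (f(ỹ + τ w) − f(ỹ))/τ`. -/
noncomputable def clarkeDeriv {E : Type*} [NormedAddCommGroup E] [NormedSpace ℝ E]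
    (f : E → ℝ) (y w : E) : ℝ :=
  Filter.limsup (fun p : E × ℝ => (f (p.1 + p.2 • w) - f p.1) / p.2)
    ((𝓝 y) ×ˢ (𝓝[>] (0 : ℝ)))

section ClarkeAuxiliary

lemma eventually_snd_pos_nhds_prod {X : Type*} [TopologicalSpace X] (y : X) :
    ∀ᶠ p : X × ℝ in 𝓝 y ×ˢ 𝓝[>] (0 : ℝ), 0 < p.2 :=
  tendsto_snd.eventually eventually_mem_nhdsWithin

variable {E : Type*} [NormedAddCommGroup E] [NormedSpace ℝ E]

lemma tendsto_fst_add_snd_smul_nhds (y w : E) :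
    Tendsto (fun p : E × ℝ => p.1 + p.2 • w) (𝓝 y ×ˢ 𝓝[>] (0 : ℝ)) (𝓝 y) := by
  have h : Tendsto (fun p : E × ℝ => p.2) (𝓝 y ×ˢ 𝓝[>] (0 : ℝ)) (𝓝 0) :=
    tendsto_snd.mono_right nhdsWithin_le_nhds
  simpa using tendsto_fst.add (h.smul_const w)

/-- The difference quotients of a locally Lipschitz function are locally bounded. -/
lemma LipschitzOnWith.eventually_abs_differenceQuotient_le {f : E → ℝ} {K : NNReal} {s : Set E}
    {y : E} (hf : LipschitzOnWith K f s) (hs : s ∈ 𝓝 y) (w : E) :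
    ∀ᶠ p : E × ℝ in 𝓝 y ×ˢ 𝓝[>] (0 : ℝ), |(f (p.1 + p.2 • w) - f p.1) / p.2| ≤ K * ‖w‖ := by
  filter_upwards [tendsto_fst_add_snd_smul_nhds y w hs, tendsto_fst hs,
    eventually_snd_pos_nhds_prod y] with p h₁ h₂ hp
  have h := hf.norm_sub_le h₁ h₂
  rw [add_sub_cancel_left, norm_smul, Real.norm_eq_abs, Real.norm_eq_abs, abs_of_pos hp] at h
  rw [abs_div, abs_of_pos hp, div_le_iff₀ hp]
  linarith

lemma LipschitzOnWith.isBoundedUnder_differenceQuotient {f : E → ℝ} {K : NNReal} {s : Set E}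
    {y : E} (hf : LipschitzOnWith K f s) (hs : s ∈ 𝓝 y) (w : E) :
    (𝓝 y ×ˢ 𝓝[>] (0 : ℝ)).IsBoundedUnder (· ≤ ·)
      (fun p : E × ℝ => (f (p.1 + p.2 • w) - f p.1) / p.2) :=
  isBoundedUnder_of_eventually_le
    ((hf.eventually_abs_differenceQuotient_le hs w).mono fun _ h => (abs_le.1 h).2)

lemma LipschitzOnWith.isCoboundedUnder_differenceQuotient {f : E → ℝ} {K : NNReal} {s : Set E}
    {y : E} (hf : LipschitzOnWith K f s) (hs : s ∈ 𝓝 y) (w : E) :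
    (𝓝 y ×ˢ 𝓝[>] (0 : ℝ)).IsCoboundedUnder (· ≤ ·)
      (fun p : E × ℝ => (f (p.1 + p.2 • w) - f p.1) / p.2) :=
  (isBoundedUnder_of_eventually_ge
    ((hf.eventually_abs_differenceQuotient_le hs w).mono
      fun _ h => (abs_le.1 h).1)).isCoboundedUnder_le

/-- Strict differentiability controls the error of the difference quotients uniformly in the
base point. -/
lemma HasStrictFDerivAt.eventually_norm_sub_smul_le {F : Type*} [NormedAddCommGroup F]
    [NormedSpace ℝ F] {g : F → E} {g' : F →L[ℝ] E} {x : F} (hg : HasStrictFDerivAt g g' x)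
    (v : F) {c : ℝ} (hc : 0 < c) :
    ∀ᶠ p : F × ℝ in 𝓝 x ×ˢ 𝓝[>] (0 : ℝ),
      ‖g (p.1 + p.2 • v) - (g p.1 + p.2 • g' v)‖ ≤ c * p.2 := by
  have ht : Tendsto (fun p : F × ℝ => (p.1 + p.2 • v, p.1)) (𝓝 x ×ˢ 𝓝[>] (0 : ℝ)) (𝓝 (x, x)) :=
    (tendsto_fst_add_snd_smul_nhds x v).prodMk_nhds tendsto_fst
  have hc' : 0 < c / (‖v‖ + 1) := by positivity
  filter_upwards [ht.eventually (hg.isLittleO.def hc'), eventually_snd_pos_nhds_prod x] with p h hp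
  simp only [add_sub_cancel_left, map_smul, norm_smul, Real.norm_eq_abs, _root_.abs_of_pos hp] at h
  rw [sub_add_eq_sub_sub]
  refine h.trans ?_
  rw [div_mul_eq_mul_div, div_le_iff₀ (by positivity)]
  nlinarith [mul_pos hc hp]

end ClarkeAuxiliary

/-- If `g : F → E` is continuously Fréchet differentiable near `x` (with derivative `Dg` at `x`)
and `f : E → ℝ` is Lipschitz on a neighborhood of `g x`, then for every direction `v`,
`(f ∘ g)°(x, v) ≤ f°(g x, Dg v)`. -/
theorem clarkeDeriv_comp_le
    {E F : Type*} [NormedAddCommGroup E] [NormedSpace ℝ E]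
    [NormedAddCommGroup F] [NormedSpace ℝ F]
    (g : F → E) (f : E → ℝ) (x : F) (Dg : F →L[ℝ] E)
    (hg : ContDiffAt ℝ 1 g x) (hDg : HasFDerivAt g Dg x)
    (hf : ∃ (K : NNReal) (s : Set E), s ∈ 𝓝 (g x) ∧ LipschitzOnWith K f s)
    (v : F) :
    clarkeDeriv (f ∘ g) x v ≤ clarkeDeriv f (g x) (Dg v) := by
  obtain ⟨K, s, hs, hf⟩ := hf
  have hg' : HasStrictFDerivAt g Dg x := hg.hasStrictFDerivAt' hDg one_ne_zero
  obtain ⟨L, t, ht, hgL⟩ := hg'.exists_lipschitzOnWith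
  have hgs : g ⁻¹' s ∈ 𝓝 x := hDg.continuousAt hs
  have hfg : LipschitzOnWith (K * L) (f ∘ g) (t ∩ g ⁻¹' s) :=
    hf.comp (hgL.mono Set.inter_subset_left) fun _ h => h.2
  have hts : t ∩ g ⁻¹' s ∈ 𝓝 x := inter_mem ht hgs
  unfold clarkeDeriv
  rw [limsup_le_iff (hfg.isCoboundedUnder_differenceQuotient hts v)
    (hfg.isBoundedUnder_differenceQuotient hts v)]
  intro c hc
  obtain ⟨b, hb, hbc⟩ := exists_between hc
  have hlt := eventually_lt_of_limsup_lt hb (hf.isBoundedUnder_differenceQuotient hs (Dg v))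
  have hΦ : Tendsto (fun p : F × ℝ => (g p.1, p.2)) (𝓝 x ×ˢ 𝓝[>] (0 : ℝ))
      (𝓝 (g x) ×ˢ 𝓝[>] (0 : ℝ)) := hDg.continuousAt.tendsto.prodMap tendsto_id
  have hε : 0 < (c - b) / (K + 1) := div_pos (sub_pos.2 hbc) (by positivity)
  filter_upwards [hΦ.eventually hlt, hg'.eventually_norm_sub_smul_le v hε,
    eventually_snd_pos_nhds_prod x, tendsto_fst_add_snd_smul_nhds x v hgs,
    hΦ.eventually (tendsto_fst_add_snd_smul_nhds (g x) (Dg v) hs)] with p h₁ h₂ hp h₃ h₄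
  have h₅ := (le_abs_self _).trans (hf.norm_sub_le h₃ h₄)
  have h₆ := mul_le_mul_of_nonneg_left h₂ K.coe_nonneg
  have h₇ : K * ((c - b) / (K + 1) * p.2) ≤ (c - b) * p.2 := by
    rw [div_mul_eq_mul_div, mul_div_assoc', div_le_iff₀ (by positivity)]
    nlinarith [mul_pos (sub_pos.2 hbc) hp]
  rw [div_lt_iff₀ hp] at h₁ ⊢
  simp only [Function.comp_apply]
  linarith
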